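/- There exist arbitrarily long extremal square-free words over the alphabet Γ = {a, b, c}: for every nonnegative integer m there is an extremal square-free word over Γ of length at least m. -/

import Mathlib

/-- A word `w` is square-free if it contains no factor `x ++ x` with `x` nonempty. -/
def SquareFree {α : Type*} (w : List α) : Prop :=
  ∀ x : List α, x ≠ [] → ¬ (x ++ x) <:+: w

/-- `v` is an extension of `w`: insert a single letter anywhere in `w`. -/
def IsExtension {α : Type*} (w v : List α) : Prop :=
  ∃ (w' w'' : List α) (a : α), w = w' ++ w'' ∧ v = w' ++ [a] ++ w''

/-- `w` is extremal square-free. -/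
def ExtremalSquareFree {α : Type*} (w : List α) : Prop :=
  SquareFree w ∧ ∀ v, IsExtension w v → ¬ SquareFree v

section Words

variable {α β : Type*}

/-- `w` has a square of period `p` starting at position `i`. -/
def HasSquareAt (w : List α) (i p : ℕ) : Prop :=
  i + 2 * p ≤ w.length ∧ ∀ j < p, w[i + j]? = w[i + p + j]?

theorem squareFree_iff {w : List α} :
    SquareFree w ↔ ∀ i p, 0 < p → ¬ HasSquareAt w i p := by
  constructor
  · rintro h i p hp ⟨hlen, heq⟩
    have hx : (w.drop i).take p ++ (w.drop i).take p = (w.drop i).take (p + p) := by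
      rw [List.take_add]
      congr 1
      refine List.ext_getElem? fun j => ?_
      simp only [List.getElem?_take, List.drop_drop, List.getElem?_drop]
      split_ifs with hj
      · exact heq j hj
      · rfl
    refine h ((w.drop i).take p) ?_ ?_
    · rw [← List.length_pos_iff, List.length_take, List.length_drop]
      omega
    · rw [hx]
      exact (List.take_prefix _ _).isInfix.trans (List.drop_suffix _ _).isInfix
  · rintro h x hx ⟨s, t, rfl⟩
    refine h s.length x.length (List.length_pos_iff.2 hx) ⟨by simp; omega, fun j hj => ?_⟩
    grind

theorem SquareFree.of_isInfix {v w : List α} (h : SquareFree w) (hv : v <:+: w) :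
    SquareFree v :=
  fun x hx hxv => h x hx (hxv.trans hv)

theorem SquareFree.cons {w : List α} {a : α} (h : SquareFree w) (ha : a ∉ w) :
    SquareFree (a :: w) := by
  intro x hx hxw
  rcases List.infix_cons_iff.1 hxw with hxw | hxw
  · obtain ⟨b, y, rfl⟩ := List.exists_cons_of_ne_nil hx
    obtain ⟨t, ht⟩ := hxw
    simp only [List.cons_append, List.cons.injEq] at ht
    apply ha
    rw [← ht.2, ← ht.1]
    simp
  · exact h x hx hxw

theorem SquareFree.concat {w : List α} {a : α} (h : SquareFree w) (ha : a ∉ w) :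
    SquareFree (w ++ [a]) := by
  intro x hx hxw
  rcases List.infix_concat_iff.1 hxw with hxw | hxw
  · obtain ⟨y, b, rfl⟩ := List.eq_nil_or_concat' x |>.resolve_left hx
    obtain ⟨t, ht⟩ := hxw
    have ht' : (t ++ (y ++ [b] ++ y)) ++ [b] = w ++ [a] := by simpa using ht
    obtain ⟨h₁, h₂⟩ := List.append_inj' ht' rfl
    apply ha
    rw [← h₁, ← List.singleton_inj.1 h₂]
    simp
  · exact h x hx hxw

theorem SquareFree.map {w : List α} {f : α → β} (h : SquareFree w)
    (hf : Function.Injective f) : SquareFree (w.map f) := by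
  rw [squareFree_iff] at h ⊢
  rintro i p hp ⟨hlen, heq⟩
  refine h i p hp ⟨by simpa using hlen, fun j hj => ?_⟩
  have := heq j hj
  rw [List.getElem?_map, List.getElem?_map] at this
  exact Option.map_injective hf this

theorem SquareFree.isChain_ne {w : List α} (h : SquareFree w) : w.IsChain (· ≠ ·) := by
  rw [List.isChain_iff_forall_rel_of_append_cons_cons]
  rintro a b s t rfl rfl
  exact h [a] (by simp) ⟨s, t, by simp⟩

theorem eq_take_append_pair_append_drop {w : List α} {a : ℕ} (ha : a + 1 < w.length) :
    w = w.take a ++ [w[a], w[a + 1]] ++ w.drop (a + 2) := by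
  rw [List.append_assoc]
  conv_lhs => rw [← List.take_append_drop a w]
  congr 1
  rw [List.drop_eq_getElem_cons (by omega), List.drop_eq_getElem_cons ha]
  rfl

theorem length_flatMap_of_uniform {H : α → List β} {q : ℕ} (hH : ∀ x, (H x).length = q)
    (w : List α) : (w.flatMap H).length = q * w.length := by
  induction w with
  | nil => simp
  | cons x w ih => simp [ih, hH]; ring

theorem getElem?_flatMap_of_uniform {H : α → List β} {q : ℕ} (hH : ∀ x, (H x).length = q)
    (w : List α) (a : ℕ) {r : ℕ} (hr : r < q) :
    (w.flatMap H)[q * a + r]? = w[a]?.bind fun x => (H x)[r]? := by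
  induction w generalizing a with
  | nil => simp
  | cons x w ih =>
    rw [List.flatMap_cons]
    cases a with
    | zero => rw [List.getElem?_append_left (by simp [hH, hr])]; simp
    | succ a =>
      rw [List.getElem?_append_right (by rw [hH]; nlinarith), hH, List.getElem?_cons_succ, ← ih]
      congr 1
      rw [mul_add, mul_one, Nat.sub_eq_of_eq_add]
      ring

/-- Every pair of consecutive letters yields an aligned factor of the image. -/
theorem flatMap_eq_append_pair {H : α → List β} {q : ℕ} (hH : ∀ x, (H x).length = q)
    {R : α → α → Prop} {w : List α} (hw : w.IsChain R) {a : ℕ} (ha : a + 1 < w.length) :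
    ∃ s t, R w[a] w[a + 1] ∧ w.flatMap H = s ++ (H w[a] ++ H w[a + 1]) ++ t ∧
      s.length = q * a := by
  refine ⟨(w.take a).flatMap H, (w.drop (a + 2)).flatMap H, ?_, ?_, ?_⟩
  · exact List.isChain_iff_getElem.1 hw a ha
  · refine (congrArg (List.flatMap H) (eq_take_append_pair_append_drop ha)).trans ?_
    simp only [List.flatMap_append, List.flatMap_cons, List.flatMap_nil, List.append_nil]
  · rw [length_flatMap_of_uniform hH, List.length_take, min_eq_left (by omega)]

end Words
section UniformMorphism

variable {α β : Type*} {H : α → List β} {q : ℕ} {R : α → α → Prop} {w : List α}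

/-- A short factor of the image of a word lies inside the image of two consecutive letters. -/
theorem exists_pair_of_factor (hH : ∀ x, (H x).length = q) (hw : w.IsChain R)
    (hlen : 2 ≤ w.length) {i n : ℕ} (hn : n ≤ q + 1) (hi : i + n ≤ q * w.length) (hq : 0 < q) :
    ∃ x y r, R x y ∧ r + n ≤ 2 * q ∧ r % q = i % q ∧
      ∀ j < n, (w.flatMap H)[i + j]? = (H x ++ H y)[r + j]? := by
  obtain ⟨a, r, ha, rfl, hr⟩ : ∃ a r, a + 1 < w.length ∧ i = q * a + r ∧ r + n ≤ 2 * q := by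
    obtain ⟨N, hN⟩ := Nat.exists_eq_add_of_le hlen
    rw [hN] at hi ⊢
    by_cases h : i / q ≤ N
    · refine ⟨i / q, i % q, by omega, (Nat.div_add_mod i q).symm, ?_⟩
      have := Nat.mod_lt i hq
      omega
    · have : (N + 1) * q ≤ i := (Nat.le_div_iff_mul_le hq).1 (by omega)
      refine ⟨N, i - q * N, by omega, ?_, ?_⟩ <;> grind
  obtain ⟨s, t, hR, hst, hs⟩ := flatMap_eq_append_pair hH hw ha
  refine ⟨_, _, r, hR, hr, by simp, fun j hj => ?_⟩
  rw [hst, List.append_assoc, List.getElem?_append_right (by omega), hs,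
    List.getElem?_append_left (by simp only [List.length_append, hH]; omega)]
  congr 1
  omega

/-- If two blocks of the image agree on a set of positions that identifies letters, then the
corresponding letters agree. -/
theorem getElem?_eq_of_flatMap_agree (hH : ∀ x, (H x).length = q) {a b lo hi : ℕ} (hhi : hi ≤ q)
    (hdist : ∀ x y, (∀ j, lo ≤ j → j < hi → (H x)[j]? = (H y)[j]?) → x = y)
    (ha : a < w.length) (hb : b < w.length)
    (h : ∀ j, lo ≤ j → j < hi → (w.flatMap H)[q * a + j]? = (w.flatMap H)[q * b + j]?) :
    w[a]? = w[b]? := by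
  rw [List.getElem?_eq_getElem ha, List.getElem?_eq_getElem hb, Option.some_inj]
  refine hdist _ _ fun j h₁ h₂ => ?_
  have := h j h₁ h₂
  rwa [getElem?_flatMap_of_uniform hH w a (by omega),
    getElem?_flatMap_of_uniform hH w b (by omega), List.getElem?_eq_getElem ha,
    List.getElem?_eq_getElem hb] at this

/-- A criterion for a uniform morphism to preserve square-freeness: images of pairs have no short
squares, factors of length `ℓ` determine their position modulo `q`, and a block is determined by
its prefix of length `m` as well as by the remaining suffix. -/
theorem SquareFree.flatMap_of_uniform {ℓ m : ℕ} (hH : ∀ x, (H x).length = q) (hℓ : 0 < ℓ)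
    (hq : 2 * (ℓ - 1) ≤ q + 1) (hℓq : ℓ ≤ q) (hmq : m ≤ q)
    (hshort : ∀ x y, R x y → ∀ i p, 0 < p → p < ℓ → ¬ HasSquareAt (H x ++ H y) i p)
    (hsync : ∀ x y x' y' r r', R x y → R x' y' → r + ℓ ≤ 2 * q → r' + ℓ ≤ 2 * q →
      (∀ j < ℓ, (H x ++ H y)[r + j]? = (H x' ++ H y')[r' + j]?) → r % q = r' % q)
    (hpre : ∀ x y, (∀ j, 0 ≤ j → j < m → (H x)[j]? = (H y)[j]?) → x = y)
    (hsuf : ∀ x y, (∀ j, m ≤ j → j < q → (H x)[j]? = (H y)[j]?) → x = y)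
    (hw : w.IsChain R) (hlen : 2 ≤ w.length) (hsf : SquareFree w) :
    SquareFree (w.flatMap H) := by
  rw [squareFree_iff] at hsf ⊢
  rintro i p hp ⟨hip, heq⟩
  rw [length_flatMap_of_uniform hH] at hip
  rcases lt_or_ge p ℓ with hpℓ | hpℓ
  · obtain ⟨x, y, r, hR, hr, -, hxy⟩ :=
      exists_pair_of_factor hH hw hlen (n := 2 * p) (by omega) hip (by omega)
    refine hshort x y hR r p hp hpℓ ⟨by simp only [List.length_append, hH]; omega, ?_⟩
    intro j hj
    rw [← hxy j (by omega), add_assoc r, ← hxy (p + j) (by omega), ← add_assoc]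
    exact heq j hj
  · obtain ⟨x, y, r, hR, hr, hri, hxy⟩ :=
      exists_pair_of_factor hH hw hlen (i := i) (n := ℓ) (by omega) (by omega) (by omega)
    obtain ⟨x', y', r', hR', hr', hri', hxy'⟩ :=
      exists_pair_of_factor hH hw hlen (i := i + p) (n := ℓ) (by omega) (by omega) (by omega)
    have hmod : i % q = (i + p) % q := by
      rw [← hri, ← hri']
      refine hsync x y x' y' r r' hR hR' hr hr' fun j hj => ?_
      rw [← hxy j hj, ← hxy' j hj]
      exact heq j (by omega)
    obtain ⟨k, rfl⟩ : q ∣ p := by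
      have : i + 0 ≡ i + p [MOD q] := hmod
      exact (Nat.modEq_zero_iff_dvd).1 (Nat.ModEq.add_left_cancel' i this).symm
    have hk : 0 < k := Nat.pos_of_mul_pos_left hp
    have hagree : ∀ t, i ≤ t → t < i + q * k →
        (w.flatMap H)[t]? = (w.flatMap H)[t + q * k]? := by
      intro t h₁ h₂
      have := heq (t - i) (by omega)
      rwa [show i + (t - i) = t by omega, show i + q * k + (t - i) = t + q * k by omega] at this
    have hrq : i % q < q := Nat.mod_lt _ (by omega)
    obtain ⟨a, s, hsq, rfl⟩ : ∃ a s, s < q ∧ i = q * a + s :=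
      ⟨i / q, i % q, hrq, (Nat.div_add_mod i q).symm⟩
    rcases le_or_gt s m with hsm | hsm
    · have hak : a + 2 * k ≤ w.length := by
        refine le_of_mul_le_mul_left (a := q) ?_ (by omega)
        linarith
      refine hsf a k hk ⟨hak, fun j hj => ?_⟩
      refine getElem?_eq_of_flatMap_agree hH le_rfl hsuf (by omega) (by omega) fun t h₁ h₂ => ?_
      have : q * (j + 1) ≤ q * k := Nat.mul_le_mul_left q hj
      rw [hagree _ (by nlinarith) (by nlinarith)]
      congr 1
      ring
    · have hak : a + 2 * k < w.length := by
        refine Nat.lt_of_mul_lt_mul_left (a := q) ?_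
        linarith
      refine hsf (a + 1) k hk ⟨by omega, fun j hj => ?_⟩
      refine getElem?_eq_of_flatMap_agree hH hmq hpre (by omega) (by omega) fun t h₁ h₂ => ?_
      have : q * (j + 1) ≤ q * k := Nat.mul_le_mul_left q hj
      rw [hagree _ (by nlinarith) (by nlinarith)]
      congr 1
      ring

end UniformMorphism

section Search

variable {α : Type*}

/-- Scans `s` and `t` in parallel for `p` consecutive agreements, where `n` agreements
immediately before the current position are already known. -/
def scanRun [BEq α] (p : ℕ) : ℕ → List α → List α → Bool
  | n, a :: s, b :: t =>
    bif a == b then n + 1 == p || scanRun p (n + 1) s t else scanRun p 0 s t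
  | _, [], _ => false
  | _, _ :: _, [] => false

/-- Decides whether `w` contains a square of period `p`. -/
def hasSquare [BEq α] (p : ℕ) (w : List α) : Bool :=
  scanRun p 0 w (w.drop p)

theorem exists_hasSquareAt_of_scanRun [BEq α] [LawfulBEq α] {p : ℕ} {w s t : List α} {n d : ℕ}
    (hs : s = w.drop d) (ht : t = w.drop (d + p)) (hn : n ≤ d)
    (hrun : ∀ j < n, w[d - n + j]? = w[d - n + p + j]?) (h : scanRun p n s t = true) :
    ∃ i, HasSquareAt w i p := by
  induction s generalizing t n d with
  | nil => simp [scanRun] at h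
  | cons a s ih =>
    cases t with
    | nil => simp [scanRun] at h
    | cons b t =>
      have hs' : s = w.drop (d + 1) := by rw [← List.drop_drop, ← hs]; rfl
      have ht' : t = w.drop (d + 1 + p) := by
        rw [add_right_comm, ← List.drop_drop, ← ht]; rfl
      have ha : w[d]? = some a := by rw [← List.head?_drop, ← hs]; rfl
      have hb : w[d + p]? = some b := by rw [← List.head?_drop, ← ht]; rfl
      have hlen : d + p < w.length := (List.getElem?_eq_some_iff.1 hb).1
      rw [scanRun] at h
      by_cases hab : a = b
      · have hrun' : ∀ j < n + 1, w[d + 1 - (n + 1) + j]? = w[d + 1 - (n + 1) + p + j]? := by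
          intro j hj
          rcases Nat.lt_succ_iff_lt_or_eq.1 hj with hj | rfl
          · have := hrun j hj
            rwa [Nat.add_sub_add_right]
          · rw [show d + 1 - (j + 1) + j = d by omega,
              show d + 1 - (j + 1) + p + j = d + p by omega, ha, hb, hab]
        simp only [hab, beq_self_eq_true, cond_true, Bool.or_eq_true, beq_iff_eq] at h
        rcases h with rfl | h
        · exact ⟨d + 1 - (n + 1), by omega, hrun'⟩
        · exact ih hs' ht' (by omega) hrun' h
      · rw [beq_false_of_ne hab, cond_false] at h
        exact ih hs' ht' (by omega) (by simp) h

theorem HasSquareAt.scanRun_eq_true [BEq α] [LawfulBEq α] {p : ℕ} {w s t : List α} {i n d : ℕ}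
    (h : HasSquareAt w i p) (hs : s = w.drop d) (ht : t = w.drop (d + p)) (hn : n < p)
    (hd : d ≤ i + n) : scanRun p n s t = true := by
  obtain ⟨hlen, heq⟩ := h
  induction s generalizing t n d with
  | nil => have := congrArg List.length hs; simp at this; omega
  | cons a s ih =>
    cases t with
    | nil => have := congrArg List.length ht; simp at this; omega
    | cons b t =>
      have hs' : s = w.drop (d + 1) := by rw [← List.drop_drop, ← hs]; rfl
      have ht' : t = w.drop (d + 1 + p) := by
        rw [add_right_comm, ← List.drop_drop, ← ht]; rfl
      have ha : w[d]? = some a := by rw [← List.head?_drop, ← hs]; rfl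
      have hb : w[d + p]? = some b := by rw [← List.head?_drop, ← ht]; rfl
      rw [scanRun]
      by_cases hab : a = b
      · simp only [hab, beq_self_eq_true, cond_true, Bool.or_eq_true, beq_iff_eq]
        by_cases hnp : n + 1 = p
        · exact Or.inl hnp
        · exact Or.inr (ih hs' ht' (by omega) (by omega))
      · rw [beq_false_of_ne hab, cond_false]
        refine ih hs' ht' (by omega) ?_
        by_contra hdi
        refine hab (Option.some_inj.1 ?_)
        have := heq (d - i) (by omega)
        rwa [show i + (d - i) = d by omega, show i + p + (d - i) = d + p by omega, ha, hb] at this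

theorem hasSquare_iff [BEq α] [LawfulBEq α] {p : ℕ} (hp : 0 < p) {w : List α} :
    hasSquare p w = true ↔ ∃ i, HasSquareAt w i p := by
  constructor
  · exact exists_hasSquareAt_of_scanRun (d := 0) (by simp) (by simp) le_rfl (by simp)
  · rintro ⟨i, h⟩
    exact h.scanRun_eq_true (d := 0) (by simp) (by simp) hp (by omega)

/-- Checks that inserting any letter between `l.reverse` and `r` creates a square with one of a
few short periods. -/
def gapBlocked (l r : List (Fin 3)) : Bool :=
  [0, 1, 2].all fun c => [1, 2, 3, 6, 8, 12, 13, 20, 21].any fun p =>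
    hasSquare p ((l.take (2 * p)).reverseAux (c :: r.take (2 * p)))

/-- Checks `gapBlocked` at the `n` consecutive gaps of `l.reverse ++ r` starting at the one
between `l.reverse` and `r`. -/
def gapsBlocked : ℕ → List (Fin 3) → List (Fin 3) → Bool
  | 0, _, _ => true
  | _ + 1, l, [] => gapBlocked l []
  | n + 1, l, a :: r => gapBlocked l (a :: r) && gapsBlocked n (a :: l) r

theorem not_squareFree_of_gapBlocked {l r : List (Fin 3)} (h : gapBlocked l r = true)
    (c : Fin 3) : ¬ SquareFree (l.reverse ++ [c] ++ r) := by
  obtain ⟨p, hp, hsq⟩ : ∃ p, 0 < p ∧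
      hasSquare p ((l.take (2 * p)).reverseAux (c :: r.take (2 * p))) = true := by
    have hc := List.all_eq_true.1 h c (by fin_cases c <;> simp)
    obtain ⟨p, hp, hsq⟩ := List.any_eq_true.1 hc
    exact ⟨p, Nat.pos_of_ne_zero fun h₀ => by simp [h₀] at hp, hsq⟩
  obtain ⟨i, hi⟩ := (hasSquare_iff hp).1 hsq
  intro hsf
  refine squareFree_iff.1 (hsf.of_isInfix ?_) i p hp hi
  refine ⟨(l.drop (2 * p)).reverse, r.drop (2 * p), ?_⟩
  have hl : l.reverse = (l.drop (2 * p)).reverse ++ (l.take (2 * p)).reverse := by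
    rw [← List.reverse_append, List.take_append_drop]
  rw [hl]
  simp [List.reverseAux_eq]

theorem not_squareFree_of_gapsBlocked {n : ℕ} {l r u v : List (Fin 3)}
    (h : gapsBlocked n l r = true) (huv : l.reverse ++ r = u ++ v) (hl : l.length ≤ u.length)
    (hu : u.length < l.length + n) (c : Fin 3) : ¬ SquareFree (u ++ [c] ++ v) := by
  induction n generalizing l r with
  | zero => omega
  | succ n ih =>
    by_cases heq : u.length = l.length
    · obtain ⟨rfl, rfl⟩ := List.append_inj huv (by simp [heq])
      refine not_squareFree_of_gapBlocked ?_ c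
      cases r <;> simp_all [gapsBlocked]
    · cases r with
      | nil =>
        have := congrArg List.length huv
        simp at this
        omega
      | cons a r =>
        rw [gapsBlocked, Bool.and_eq_true] at h
        refine ih h.2 (by simpa using huv) ?_ ?_ <;> simp only [List.length_cons] <;> omega

/-- The factor version of `not_squareFree_of_gapsBlocked`. -/
theorem not_squareFree_of_gapsBlocked_factor {n : ℕ} {l r s t u v : List (Fin 3)}
    (h : gapsBlocked n l r = true) (huv : s ++ (l.reverse ++ r) ++ t = u ++ v)
    (hl : s.length + l.length ≤ u.length) (hu : u.length < s.length + l.length + n)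
    (hr : u.length ≤ s.length + l.length + r.length) (c : Fin 3) :
    ¬ SquareFree (u ++ [c] ++ v) := by
  obtain ⟨x, y, hxy, hx⟩ : ∃ x y, l.reverse ++ r = x ++ y ∧ x.length = u.length - s.length :=
    ⟨_, _, (List.take_append_drop (u.length - s.length) _).symm, by simp; omega⟩
  obtain ⟨rfl, rfl⟩ : s ++ x = u ∧ y ++ t = v := by
    refine List.append_inj ?_ (by rw [List.length_append]; omega)
    rw [← huv, hxy]
    simp
  rw [List.length_append] at hl hu
  intro hsf
  refine not_squareFree_of_gapsBlocked h hxy (by omega) (by omega) c (hsf.of_isInfix ?_)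
  exact ⟨s, t, by simp⟩

/-- Removes the leading letter of a word if it equals `c`. -/
def branch [BEq α] (c : α) : List α × ℕ → Option (List α × ℕ)
  | ([], _) => none
  | (a :: t, o) => bif a == c then some (t, o) else none

/-- Checks that all offsets are congruent modulo `q`. -/
def constOffset (q : ℕ) : List (List α × ℕ) → Bool
  | [] => true
  | u :: S => S.all fun v => u.2 % q == v.2 % q

/-- Checks that words of `S` with the same first `n` letters have offsets congruent
modulo `q`. -/
def separated (q : ℕ) : ℕ → List (List (Fin 3) × ℕ) → Bool
  | 0, S => constOffset q S
  | n + 1, S => constOffset q S || [0, 1, 2].all fun c => separated q n (S.filterMap (branch c))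

theorem mod_eq_of_constOffset {q : ℕ} {S : List (List α × ℕ)} (h : constOffset q S = true)
    {u v : List α × ℕ} (hu : u ∈ S) (hv : v ∈ S) : u.2 % q = v.2 % q := by
  cases S with
  | nil => simp at hu
  | cons z S =>
    have hz : ∀ y ∈ z :: S, z.2 % q = y.2 % q := by
      simpa [constOffset] using h
    rw [← hz u hu, ← hz v hv]

theorem mod_eq_of_separated {q n : ℕ} {S : List (List (Fin 3) × ℕ)}
    (h : separated q n S = true) {u v : List (Fin 3)} {o o' : ℕ} (hu : (u, o) ∈ S)
    (hv : (v, o') ∈ S) (hlen : n ≤ u.length) (heq : ∀ j < n, u[j]? = v[j]?) :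
    o % q = o' % q := by
  induction n generalizing S u v with
  | zero => exact mod_eq_of_constOffset h hu hv
  | succ n ih =>
    rw [separated, Bool.or_eq_true] at h
    rcases h with h | h
    · exact mod_eq_of_constOffset h hu hv
    · have h₀ := heq 0 (by omega)
      obtain _ | ⟨c, u⟩ := u
      · simp at hlen
      obtain _ | ⟨c', v⟩ := v
      · simp at h₀
      obtain rfl : c = c' := by simpa using h₀
      have hc := List.all_eq_true.1 h c (by fin_cases c <;> simp)
      refine ih hc (u := u) (v := v) ?_ ?_ (by simpa using hlen) fun j hj => ?_
      · exact List.mem_filterMap.2 ⟨_, hu, by simp [branch]⟩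
      · exact List.mem_filterMap.2 ⟨_, hv, by simp [branch]⟩
      · simpa using heq (j + 1) (by omega)

theorem drop_mem_zipIdx_tails {G : List α} {r : ℕ} (hr : r ≤ G.length) :
    (G.drop r, r) ∈ G.tails.zipIdx := by
  rw [List.mk_mem_zipIdx_iff_getElem?, List.getElem?_eq_getElem (by simp; omega),
    List.getElem_tails]

end Search

/-- An `81`-uniform square-free morphism whose images admit no square-free insertion. The letters
`3` and `4` stand for the blocks at the left and right end of an extremal word. -/
def block : Fin 5 → List (Fin 3)
  | 0 =>
    [1, 0, 2, 0, 1, 2, 0, 2, 1, 0, 2, 0, 1, 2, 1, 0, 2, 1, 2, 0, 1, 0, 2, 0, 1, 2, 0,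
      2, 1, 0, 1, 2, 0, 1, 0, 2, 1, 2, 0, 2, 1, 0, 2, 0, 1, 2, 0, 2, 1, 0, 1, 2, 0, 1,
      0, 2, 1, 0, 1, 2, 1, 0, 2, 0, 1, 2, 0, 2, 1, 0, 1, 2, 0, 1, 0, 2, 1, 2, 0, 1, 2]
  | 1 =>
    [1, 0, 2, 0, 1, 2, 0, 2, 1, 0, 2, 0, 1, 2, 1, 0, 2, 1, 2, 0, 1, 0, 2, 0, 1, 2, 0,
      2, 1, 0, 1, 2, 0, 1, 0, 2, 1, 2, 0, 2, 1, 0, 2, 0, 1, 2, 0, 2, 1, 0, 1, 2, 0, 1,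
      0, 2, 1, 2, 0, 1, 2, 1, 0, 2, 0, 1, 2, 0, 2, 1, 0, 1, 2, 1, 0, 2, 1, 2, 0, 1, 2]
  | 2 =>
    [1, 0, 2, 0, 1, 2, 0, 2, 1, 0, 2, 0, 1, 2, 1, 0, 2, 1, 2, 0, 1, 0, 2, 0, 1, 2, 0,
      2, 1, 0, 2, 0, 1, 0, 2, 1, 0, 1, 2, 0, 2, 1, 0, 2, 0, 1, 2, 1, 0, 1, 2, 0, 1, 0,
      2, 1, 0, 1, 2, 0, 2, 1, 0, 2, 0, 1, 2, 1, 0, 2, 1, 2, 0, 1, 0, 2, 1, 0, 1, 2, 0]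
  | 3 =>
    [0, 2, 0, 1, 2, 0, 2, 1, 0, 1, 2, 1, 0, 2, 0, 1, 2, 0, 2, 1, 0, 1, 2, 0, 1, 0, 2,
      1, 2, 0, 1, 2, 1, 0, 2, 0, 1, 2, 0, 2, 1, 0, 1, 2, 0, 1, 0, 2, 0, 1, 2, 0, 2, 1,
      0, 1, 2, 1, 0, 2, 0, 1, 2, 1, 0, 1, 2, 0, 2, 1, 0, 1, 2, 1, 0, 2, 1, 2, 0, 1, 2]
  | 4 =>
    [1, 0, 2, 0, 1, 2, 0, 2, 1, 0, 2, 0, 1, 2, 1, 0, 2, 1, 2, 0, 1, 0, 2, 1, 0, 1, 2,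
      1, 0, 2, 0, 1, 0, 2, 1, 0, 1, 2, 0, 1, 0, 2, 1, 2, 0, 1, 2, 1, 0, 2, 0, 1, 2, 0,
      2, 1, 0, 1, 2, 0, 1, 0, 2, 1, 2, 0, 1, 2, 1, 0, 2, 0, 1, 0, 2, 1, 2, 0, 1, 2, 1]

/-- The pairs of letters allowed to be consecutive: `3` may occur only at the beginning and `4`
only at the end. -/
def Adjacent (x y : Fin 5) : Prop := x ≠ y ∧ x ≠ 4 ∧ y ≠ 3 ∧ (x = 3 → y ≠ 4)

instance : DecidableRel Adjacent := fun _ _ => inferInstanceAs (Decidable (_ ∧ _))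

/-- The list of all adjacent pairs. -/
def adjacentPairs : List (Fin 5 × Fin 5) :=
  ((List.finRange 5).product (List.finRange 5)).filter fun z => decide (Adjacent z.1 z.2)

theorem mem_adjacentPairs {x y : Fin 5} (h : Adjacent x y) : (x, y) ∈ adjacentPairs :=
  List.mem_filter.2 ⟨List.pair_mem_product.2 ⟨List.mem_finRange x, List.mem_finRange y⟩,
    decide_eq_true h⟩

/-- All suffixes of images of adjacent pairs, together with their positions. -/
def windows : List (List (Fin 3) × ℕ) :=
  adjacentPairs.flatMap fun z => (block z.1 ++ block z.2).tails.zipIdx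

theorem length_block (x : Fin 5) : (block x).length = 81 := by
  fin_cases x <;> rfl

set_option maxRecDepth 100000 in
theorem not_hasSquare_block_append :
    (adjacentPairs.all fun z => (List.range 37).all fun p =>
      !hasSquare (p + 1) (block z.1 ++ block z.2)) = true := by
  decide +kernel

set_option maxRecDepth 100000 in
theorem separated_windows : separated 81 38 windows = true := by
  decide +kernel

set_option maxRecDepth 100000 in
theorem block_injective_of_take :
    ∀ x y, (block x).take 60 = (block y).take 60 → x = y := by
  decide +kernel

set_option maxRecDepth 100000 in
theorem block_injective_of_drop :
    ∀ x y, (block x).drop 60 = (block y).drop 60 → x = y := by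
  decide +kernel

set_option maxRecDepth 100000 in
theorem gapsBlocked_middle : ∀ x y, Adjacent x y →
    gapsBlocked 81 ((block x).take 40).reverse ((block x).drop 40 ++ block y) = true := by
  decide +kernel

set_option maxRecDepth 100000 in
theorem gapsBlocked_left : ∀ y, Adjacent 3 y → gapsBlocked 40 [] (block 3 ++ block y) = true := by
  decide +kernel

set_option maxRecDepth 100000 in
theorem gapsBlocked_right : ∀ x, Adjacent x 4 →
    gapsBlocked 42 (block x ++ (block 4).take 40).reverse ((block 4).drop 40) = true := by
  decide +kernel

theorem SquareFree.flatMap_block {w : List (Fin 5)} (hw : w.IsChain Adjacent)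
    (hlen : 2 ≤ w.length) (hsf : SquareFree w) : SquareFree (w.flatMap block) := by
  refine hsf.flatMap_of_uniform (ℓ := 38) (m := 60) length_block (by norm_num) (by norm_num)
    (by norm_num) (by norm_num) ?_ ?_ ?_ ?_ hw hlen
  · intro x y hxy i p hp hpℓ hsq
    have h₁ := List.all_eq_true.1 not_hasSquare_block_append _ (mem_adjacentPairs hxy)
    have h₂ := List.all_eq_true.1 h₁ (p - 1) (List.mem_range.2 (by omega))
    rw [Nat.sub_add_cancel hp, (hasSquare_iff hp).2 ⟨i, hsq⟩] at h₂
    exact absurd h₂ (by decide)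
  · intro x y x' y' r r' hxy hxy' hr hr' heq
    have hmem : ∀ {x y : Fin 5} {r : ℕ}, Adjacent x y → r + 38 ≤ 2 * 81 →
        ((block x ++ block y).drop r, r) ∈ windows := fun h hr =>
      List.mem_flatMap.2 ⟨_, mem_adjacentPairs h, drop_mem_zipIdx_tails (by
        simp only [List.length_append, length_block]; omega)⟩
    refine mod_eq_of_separated separated_windows (hmem hxy hr) (hmem hxy' hr') ?_ ?_
    · simp only [List.length_drop, List.length_append, length_block]
      omega
    · simpa only [List.getElem?_drop] using heq
  · intro x y h
    refine block_injective_of_take x y (List.ext_getElem? fun j => ?_)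
    simp only [List.getElem?_take]
    split_ifs with hj
    · exact h j (Nat.zero_le j) hj
    · rfl
  · intro x y h
    refine block_injective_of_drop x y (List.ext_getElem? fun j => ?_)
    simp only [List.getElem?_drop]
    by_cases hj : 60 + j < 81
    · exact h _ (by omega) hj
    · rw [List.getElem?_eq_none (by rw [length_block]; omega),
        List.getElem?_eq_none (by rw [length_block]; omega)]

/-- If `w` starts with `3` and ends with `4`, then no letter can be inserted into its image. -/
theorem not_squareFree_of_isExtension_flatMap_block {w : List (Fin 5)}
    (hw : w.IsChain Adjacent) (hlen : 2 ≤ w.length) (hhead : w[0]? = some 3)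
    (hlast : w[w.length - 1]? = some 4) {v : List (Fin 3)}
    (hv : IsExtension (w.flatMap block) v) : ¬ SquareFree v := by
  obtain ⟨u, u', c, huv, rfl⟩ := hv
  have hu : u.length ≤ 81 * w.length := by
    rw [← length_flatMap_of_uniform length_block w, huv, List.length_append]
    omega
  have hlenb : ∀ x, (block x).length = 81 := length_block
  rcases lt_or_ge u.length 40 with h₁ | h₁
  · obtain ⟨s, t, hR, hst, hs⟩ := flatMap_eq_append_pair length_block hw (a := 0) (by omega)
    rw [List.getElem?_eq_getElem (by omega), Option.some_inj] at hhead
    rw [hhead] at hR hst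
    refine not_squareFree_of_gapsBlocked_factor (gapsBlocked_left _ hR) (s := s) (t := t)
      (by rw [← huv, hst]; rfl) ?_ ?_ ?_ c <;> simp [hlenb, hs] <;> omega
  rcases lt_or_ge u.length (81 * (w.length - 1) + 40) with h₂ | h₂
  · obtain ⟨s, t, hR, hst, hs⟩ := flatMap_eq_append_pair length_block hw
      (a := (u.length - 40) / 81) (by omega)
    refine not_squareFree_of_gapsBlocked_factor (gapsBlocked_middle _ _ hR) (s := s) (t := t)
      ?_ ?_ ?_ ?_ c
    · rw [← huv, hst, List.reverse_reverse, ← List.append_assoc (List.take _ _),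
        List.take_append_drop]
    all_goals simp [hlenb, hs]; omega
  · obtain ⟨s, t, hR, hst, hs⟩ := flatMap_eq_append_pair length_block hw (a := w.length - 2)
      (by omega)
    have hlast' : w[w.length - 2 + 1] = 4 := by
      rw [← Option.some_inj, ← List.getElem?_eq_getElem, ← hlast]
      congr 1
      omega
    rw [hlast'] at hR hst
    refine not_squareFree_of_gapsBlocked_factor (gapsBlocked_right _ hR) (s := s) (t := t)
      ?_ ?_ ?_ ?_ c
    · rw [← huv, hst, List.reverse_reverse, List.append_assoc (block _),
        List.take_append_drop]
    all_goals simp [hlenb, hs]; omega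

/-- The inclusion of the ordinary letters. -/
abbrev ordinary : Fin 3 → Fin 5 := Fin.castLE (by norm_num)

theorem ordinary_injective : Function.Injective ordinary := Fin.castLE_injective _

theorem ordinary_lt (x : Fin 3) : ordinary x < 3 := x.2

theorem adjacent_ordinary {x y : Fin 3} (h : x ≠ y) : Adjacent (ordinary x) (ordinary y) := by
  revert x y
  decide

theorem SquareFree.isChain_adjacent {u : List (Fin 3)} (h : SquareFree u) :
    (u.map ordinary).IsChain Adjacent :=
  (List.isChain_map ordinary).2 (h.isChain_ne.imp fun _ _ => adjacent_ordinary)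

theorem exists_squareFree_length_ge (m : ℕ) :
    ∃ u : List (Fin 3), m ≤ u.length ∧ 2 ≤ u.length ∧ SquareFree u := by
  induction m with
  | zero =>
    refine ⟨[0, 1], by simp, by simp, ?_⟩
    have h : SquareFree ([] : List (Fin 3)) := fun x hx hxn => by simp_all
    exact (h.cons (a := 1) (by simp)).cons (by simp)
  | succ m ih =>
    obtain ⟨u, hm, hu, hsf⟩ := ih
    have hlen := length_flatMap_of_uniform length_block (u.map ordinary)
    rw [List.length_map] at hlen
    exact ⟨(u.map ordinary).flatMap block, by omega, by omega,
      (hsf.map ordinary_injective).flatMap_block hsf.isChain_adjacent (by simpa using hu)⟩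

/-- There are arbitrarily long extremal square-free ternary words. -/
theorem arbitrarily_long_extremal_squarefree (m : ℕ) :
    ∃ w : List (Fin 3), m ≤ w.length ∧ ExtremalSquareFree w := by
  obtain ⟨u, hm, hu, hsf⟩ := exists_squareFree_length_ge m
  have hmem : ∀ x ∈ u.map ordinary, x < 3 := by
    intro x hx
    obtain ⟨y, -, rfl⟩ := List.mem_map.1 hx
    exact ordinary_lt y
  have h₄ : 4 ∉ u.map ordinary := fun h => absurd (hmem _ h) (by decide)
  have h₃ : 3 ∉ u.map ordinary ++ [4] := by
    rw [List.mem_append, not_or]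
    exact ⟨fun h => absurd (hmem _ h) (by decide), by decide⟩
  have hchain : (3 :: (u.map ordinary ++ [4])).IsChain Adjacent := by
    have hleft : ∀ x : Fin 5, x < 3 → Adjacent 3 x := by decide
    have hright : ∀ x : Fin 5, x < 3 → Adjacent x 4 := by decide
    refine List.isChain_cons.2 ⟨fun x hx => hleft x (hmem x ?_), ?_⟩
    · rw [List.head?_append_of_ne_nil _ (by rintro h; simp_all)] at hx
      exact List.mem_of_mem_head? hx
    · refine List.isChain_append.2 ⟨hsf.isChain_adjacent, by simp, fun x hx y hy => ?_⟩
      obtain rfl : 4 = y := by simpa using hy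
      exact hright x (hmem x (List.mem_of_mem_getLast? hx))
  have hlen : 2 ≤ (3 :: (u.map ordinary ++ [4])).length := by simp
  refine ⟨(3 :: (u.map ordinary ++ [4])).flatMap block, ?_, ?_, fun v hv => ?_⟩
  · rw [length_flatMap_of_uniform length_block]
    simp only [List.length_cons, List.length_append, List.length_map]
    omega
  · exact (((hsf.map ordinary_injective).concat h₄).cons h₃).flatMap_block hchain hlen
  · exact not_squareFree_of_isExtension_flatMap_block hchain hlen (by simp) (by simp) hv
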